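/- The following exact integral evaluation holds: G₁(0) + 2^{−1/3}·G₂(0) = 7√3/12 + Γ(1/4)²/(4√π). Equivalently, ∫_0^{3^{−1/4}} t^{−1/3}[(1 + (1 − t⁸/27)^{1/2})^{1/3} + (1 − (1 − t⁸/27)^{1/2})^{1/3}] dt + 2^{−1/3}·∫_0^{3^{−1/4}} t^{−1/3}[(1 + (1 − t⁸/432)^{1/2})^{1/3} + (1 − (1 − t⁸/432)^{1/2})^{1/3}] dt = 7√3/12 + Γ(1/4)²/(4√π). -/

import Mathlib

open Real

/-- G₁(y) = ∫_y^{3^{−1/4}} t^{−1/3}·[(1 + √(1 − t⁸/27))^{1/3} + (1 − √(1 − t⁸/27))^{1/3}] dt. -/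
noncomputable def G1 (y : ℝ) : ℝ :=
  ∫ t in y..(3:ℝ) ^ (-(1:ℝ)/4),
    t ^ (-(1:ℝ)/3) * ((1 + Real.sqrt (1 - t ^ 8 / 27)) ^ ((1:ℝ)/3)
      + (1 - Real.sqrt (1 - t ^ 8 / 27)) ^ ((1:ℝ)/3))

/-- G₂(y) = ∫_y^{3^{−1/4}} t^{−1/3}·[(1 + √(1 − t⁸/432))^{1/3} + (1 − √(1 − t⁸/432))^{1/3}] dt. -/
noncomputable def G2 (y : ℝ) : ℝ :=
  ∫ t in y..(3:ℝ) ^ (-(1:ℝ)/4),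
    t ^ (-(1:ℝ)/3) * ((1 + Real.sqrt (1 - t ^ 8 / 432)) ^ ((1:ℝ)/3)
      + (1 - Real.sqrt (1 - t ^ 8 / 432)) ^ ((1:ℝ)/3))

open MeasureTheory Set intervalIntegral

lemma intervalIntegrable_beta {α β : ℝ} (hα : 0 < α) (hβ : 0 < β) :
    IntervalIntegrable (fun x : ℝ => x ^ (α - 1) * (1 - x) ^ (β - 1)) volume 0 1 := by
  have h := Complex.betaIntegral_convergent (u := α) (v := β) (by simpa) (by simpa)
  rw [intervalIntegrable_iff_integrableOn_Ioc_of_le zero_le_one] at h ⊢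
  refine IntegrableOn.congr_fun h.re (fun x hx => ?_) measurableSet_Ioc
  have h1 : (0 : ℝ) ≤ 1 - x := by linarith [hx.2]
  have key : (x : ℂ) ^ ((α : ℂ) - 1) * (1 - (x : ℂ)) ^ ((β : ℂ) - 1)
      = ((x ^ (α - 1) * (1 - x) ^ (β - 1) : ℝ) : ℂ) := by
    push_cast [Complex.ofReal_cpow hx.1.le, Complex.ofReal_cpow h1]
    rfl
  simp only [key]
  exact Complex.ofReal_re _

lemma integral_beta {α β : ℝ} (hα : 0 < α) (hβ : 0 < β) :
    ∫ x in (0 : ℝ)..1, x ^ (α - 1) * (1 - x) ^ (β - 1) =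
      Gamma α * Gamma β / Gamma (α + β) := by
  have h := ProbabilityTheory.beta_eq_betaIntegralReal α β hα hβ
  rw [ProbabilityTheory.beta] at h
  have key : Complex.betaIntegral α β
      = ((∫ x in (0 : ℝ)..1, x ^ (α - 1) * (1 - x) ^ (β - 1) : ℝ) : ℂ) := by
    rw [Complex.betaIntegral, ← intervalIntegral.integral_ofReal]
    refine intervalIntegral.integral_congr fun x hx => ?_
    rw [uIcc_of_le zero_le_one] at hx
    have h1 : (0 : ℝ) ≤ 1 - x := by linarith [hx.2]
    push_cast [Complex.ofReal_cpow hx.1, Complex.ofReal_cpow h1]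
    rfl
  rw [h, key, Complex.ofReal_re]

/-- The integrand `1 / √(m (1 - m²))` of the lemniscatic integral. -/
noncomputable def lemniscaticKernel (m : ℝ) : ℝ := (√(m * (1 - m ^ 2)))⁻¹

lemma rpow_neg_half {x : ℝ} (hx : 0 ≤ x) : x ^ ((1 : ℝ) / 2 - 1) = (√x)⁻¹ := by
  rw [sqrt_eq_rpow, ← rpow_neg hx]; norm_num

lemma intervalIntegrable_lemniscaticKernel :
    IntervalIntegrable lemniscaticKernel volume 0 1 := by
  have h := (intervalIntegrable_beta (α := 1 / 2) (β := 1 / 2) (by norm_num)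
    (by norm_num)).mul_continuousOn (g := fun x : ℝ => (√(1 + x))⁻¹) (by
      refine ContinuousOn.inv₀ (by fun_prop) fun x hx => ?_
      rw [uIcc_of_le zero_le_one] at hx
      exact (sqrt_pos.2 (by linarith [hx.1])).ne')
  refine h.congr fun x hx => ?_
  rw [uIoc_of_le zero_le_one] at hx
  have h1 : (0 : ℝ) ≤ 1 - x := by linarith [hx.2]
  rw [rpow_neg_half hx.1.le, rpow_neg_half h1, lemniscaticKernel, ← mul_inv, ← mul_inv,
    ← sqrt_mul hx.1.le, ← sqrt_mul (by nlinarith [hx.1])]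
  ring_nf

lemma intervalIntegrable_lemniscaticKernel_of_mem {a b : ℝ} (ha : a ∈ Icc (0 : ℝ) 1)
    (hb : b ∈ Icc (0 : ℝ) 1) : IntervalIntegrable lemniscaticKernel volume a b := by
  refine intervalIntegrable_lemniscaticKernel.mono_set ?_
  rw [uIcc_of_le zero_le_one]
  exact uIcc_subset_Icc ha hb

lemma continuousOn_lemniscaticKernel : ContinuousOn lemniscaticKernel (Ioo 0 1) := by
  refine ContinuousOn.inv₀ (by fun_prop) fun x hx => ?_
  have hpos : 0 < √(x * (1 - x ^ 2)) := sqrt_pos.2 (mul_pos hx.1 (by nlinarith [hx.1, hx.2]))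
  positivity

/-- The substitution `x = m²` turns the complete lemniscatic integral into a Beta integral. -/
lemma integral_lemniscaticKernel_eq_beta :
    ∫ m in (0 : ℝ)..1, lemniscaticKernel m =
      1 / 2 * (Gamma (1 / 4) * Gamma (1 / 2) / Gamma (3 / 4)) := by
  have hpt : ∀ x ∈ Ioc (0 : ℝ) 1, 2 * lemniscaticKernel x =
      ((fun y : ℝ => y ^ ((1 : ℝ) / 4 - 1) * (1 - y) ^ ((1 : ℝ) / 2 - 1)) ∘
        fun m : ℝ => m ^ 2) x * (2 * x) := by
    intro x hx
    have h1 : 0 ≤ 1 - x ^ 2 := by nlinarith [hx.1, hx.2]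
    have h2 : (x ^ 2) ^ ((1 : ℝ) / 4 - 1) = (√x)⁻¹ * x⁻¹ := by
      rw [← rpow_natCast, ← rpow_mul hx.1.le, ← rpow_neg_half hx.1.le, ← rpow_neg_one x,
        ← rpow_add hx.1]
      norm_num
    have := hx.1.ne'
    simp only [Function.comp]
    rw [h2, rpow_neg_half h1, lemniscaticKernel, sqrt_mul hx.1.le, mul_inv]
    field_simp
  have hsub := integral_comp_mul_deriv''' (a := 0) (b := 1) (f := fun m : ℝ => m ^ 2)
    (f' := fun m => 2 * m)
    (g := fun y : ℝ => y ^ ((1 : ℝ) / 4 - 1) * (1 - y) ^ ((1 : ℝ) / 2 - 1))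
    (by fun_prop) (fun x _ => by simpa using (hasDerivAt_pow 2 x).hasDerivWithinAt)
    (by
      rintro _ ⟨x, hx, rfl⟩
      rw [min_eq_left zero_le_one, max_eq_right zero_le_one] at hx
      have h1 : x ^ 2 ≠ 0 := (pow_pos hx.1 2).ne'
      have h2 : 1 - x ^ 2 ≠ 0 := by nlinarith [hx.1, hx.2]
      exact ((continuousAt_id.rpow_const (Or.inl h1)).mul
        ((continuousAt_const.sub continuousAt_id).rpow_const (Or.inl h2))).continuousWithinAt)
    (by
      refine ((intervalIntegrable_iff').1 (intervalIntegrable_beta (α := 1 / 4) (β := 1 / 2)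
        (by norm_num) (by norm_num))).mono_set ?_
      rw [uIcc_of_le zero_le_one]
      rintro _ ⟨x, hx, rfl⟩
      exact ⟨by positivity, by nlinarith [hx.1, hx.2]⟩)
    (by
      rw [← intervalIntegrable_iff']
      refine (intervalIntegrable_lemniscaticKernel.const_mul 2).congr fun x hx => ?_
      rw [uIoc_of_le zero_le_one] at hx
      exact hpt x hx)
  have hcongr := integral_congr_ae (μ := volume) (a := 0) (b := 1) (ae_of_all _ fun x hx =>
    hpt x (by rwa [uIoc_of_le zero_le_one] at hx))
  rw [intervalIntegral.integral_const_mul, hsub] at hcongr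
  norm_num only [one_pow, zero_pow, ne_eq] at hcongr
  have hB := integral_beta (α := 1 / 4) (β := 1 / 2) (by norm_num) (by norm_num)
  norm_num at hB hcongr ⊢
  linarith

lemma integral_lemniscaticKernel :
    ∫ m in (0 : ℝ)..1, lemniscaticKernel m = √2 / 2 * (Gamma (1 / 4) ^ 2 / (2 * √π)) := by
  have h := Gamma_mul_Gamma_one_sub (1 / 4)
  rw [show π * (1 / 4) = π / 4 by ring, sin_pi_div_four] at h
  norm_num at h
  have h3 : 0 < Gamma (3 / 4) := Gamma_pos_of_pos (by norm_num)
  have hp : 0 < √π := sqrt_pos.2 pi_pos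
  have h2 : 0 < √2 := by positivity
  rw [integral_lemniscaticKernel_eq_beta, Gamma_one_half_eq]
  have hπ : √π ^ 2 = π := sq_sqrt pi_pos.le
  have h22 : √2 ^ 2 = 2 := sq_sqrt zero_le_two
  have hrefl : Gamma (1 / 4) * Gamma (3 / 4) * √2 = 2 * √π ^ 2 := by
    norm_num only; rw [h, hπ]; field_simp
  field_simp
  linear_combination -hrefl

/-- The involution `m ↦ (1 - m) / (1 + m)` preserves the lemniscatic integral. -/
lemma integral_lemniscaticKernel_mobius :
    ∫ m in (0 : ℝ)..(1 / 3), lemniscaticKernel m = ∫ m in (1 / 2 : ℝ)..1, lemniscaticKernel m := by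
  have hpt : ∀ x ∈ Ioc (0 : ℝ) (1 / 3), -lemniscaticKernel x =
      (lemniscaticKernel ∘ fun m : ℝ => (1 - m) / (1 + m)) x * (-2 / (1 + x) ^ 2) := by
    intro x hx
    have h0 := hx.1
    have h1 : 0 < 1 + x := by linarith
    have h2 : 0 < 1 - x := by linarith [hx.2]
    simp only [Function.comp, lemniscaticKernel]
    rw [show (1 - x) / (1 + x) * (1 - ((1 - x) / (1 + x)) ^ 2)
      = x * (1 - x ^ 2) * (2 / (1 + x) ^ 2) ^ 2 by field_simp; ring,
      sqrt_mul (mul_nonneg h0.le (by nlinarith)), sqrt_sq (by positivity)]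
    field_simp
  have hle : (0 : ℝ) ≤ 1 / 3 := by norm_num
  have hsub := integral_comp_mul_deriv''' (a := 0) (b := 1 / 3)
    (f := fun m : ℝ => (1 - m) / (1 + m)) (f' := fun x => -2 / (1 + x) ^ 2)
    (g := lemniscaticKernel)
    (by
      refine ContinuousOn.div (by fun_prop) (by fun_prop) fun x hx => ?_
      rw [uIcc_of_le hle] at hx
      linarith [hx.1])
    (fun x hx => by
      rw [min_eq_left hle] at hx
      have h1 : 1 + x ≠ 0 := by linarith [hx.1]
      refine HasDerivAt.hasDerivWithinAt ?_
      convert! ((hasDerivAt_id x).const_sub 1).div ((hasDerivAt_id x).const_add 1) h1 using 1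
      simp only [id]
      ring)
    (by
      refine continuousOn_lemniscaticKernel.mono ?_
      rw [min_eq_left hle, max_eq_right hle]
      rintro _ ⟨x, hx, rfl⟩
      have h1 : 0 < 1 + x := by linarith [hx.1]
      exact ⟨div_pos (by linarith [hx.2]) h1, (div_lt_one h1).2 (by linarith [hx.1])⟩)
    (by
      refine ((intervalIntegrable_iff').1 intervalIntegrable_lemniscaticKernel).mono_set ?_
      rw [uIcc_of_le zero_le_one, uIcc_of_le hle]
      rintro _ ⟨x, hx, rfl⟩
      have h1 : 0 < 1 + x := by linarith [hx.1]
      exact ⟨div_nonneg (by linarith [hx.2]) h1.le, (div_le_one h1).2 (by linarith [hx.1])⟩)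
    (by
      rw [← intervalIntegrable_iff']
      refine (intervalIntegrable_lemniscaticKernel_of_mem (a := 0) (b := 1 / 3) (by norm_num)
        (by norm_num)).neg.congr fun x hx => ?_
      rw [uIoc_of_le hle] at hx
      exact hpt x hx)
  have hcongr := integral_congr_ae (μ := volume) (a := 0) (b := 1 / 3) (ae_of_all _ fun x hx =>
    hpt x (by rwa [uIoc_of_le hle] at hx))
  rw [intervalIntegral.integral_neg, hsub] at hcongr
  norm_num at hcongr
  rw [integral_symm (1 / 2)] at hcongr
  norm_num at hcongr ⊢
  exact hcongr

/-- Cardano formula: the sum of the two cube roots is the positive root of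
`s³ = 2 + 3 c^{1/3} s`, which is rational up to a cube root in the parameter `m`. -/
lemma cardano_sum {m c : ℝ} (hm0 : 0 < m) (hm1 : m < 1)
    (hc : c = 4 * m ^ 6 / (27 * (1 - m ^ 2) ^ 2)) (hc1 : c ≤ 1) :
    (1 + √(1 - c)) ^ ((1 : ℝ) / 3) + (1 - √(1 - c)) ^ ((1 : ℝ) / 3) =
      (2 / (1 - m ^ 2)) ^ ((1 : ℝ) / 3) := by
  have he : 0 < 1 - m ^ 2 := by nlinarith
  have hc0 : 0 < c := by rw [hc]; positivity
  have cube : ∀ {x : ℝ}, 0 ≤ x → (x ^ ((1 : ℝ) / 3)) ^ 3 = x := fun {x} hx => by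
    rw [← rpow_natCast, ← rpow_mul hx]; norm_num
  have hw : √(1 - c) ^ 2 = 1 - c := sq_sqrt (by linarith)
  have hw0 := sqrt_nonneg (1 - c)
  have hw1 : √(1 - c) < 1 := by nlinarith
  have hA := cube (x := 1 + √(1 - c)) (by linarith)
  have hB := cube (x := 1 - √(1 - c)) (by linarith)
  have hs := cube (x := 2 / (1 - m ^ 2)) (by positivity)
  have hA0 : 0 < (1 + √(1 - c)) ^ ((1 : ℝ) / 3) := rpow_pos_of_pos (by linarith) _
  have hB0 : 0 < (1 - √(1 - c)) ^ ((1 : ℝ) / 3) := rpow_pos_of_pos (by linarith) _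
  have hs0 : 0 < (2 / (1 - m ^ 2)) ^ ((1 : ℝ) / 3) := rpow_pos_of_pos (by positivity) _
  generalize (1 + √(1 - c)) ^ ((1 : ℝ) / 3) = A at *
  generalize (1 - √(1 - c)) ^ ((1 : ℝ) / 3) = B at *
  generalize (2 / (1 - m ^ 2)) ^ ((1 : ℝ) / 3) = s at *
  have hAB : (A * B) ^ 3 = c := by
    rw [mul_pow, hA, hB]; linear_combination -hw
  have hPs : 3 * (A * B) * s = 2 * m ^ 2 / (1 - m ^ 2) := by
    refine (pow_left_inj₀ (n := 3) (by positivity) (by positivity) (by norm_num)).1 ?_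
    rw [mul_pow, mul_pow, hAB, hs, hc]
    field_simp
    ring
  have hs' : s ^ 3 = 2 + 3 * (A * B) * s := by
    rw [hs, hPs]; field_simp; ring
  have hS : (A + B) ^ 3 = 2 + 3 * (A * B) * (A + B) := by
    linear_combination hA + hB
  have hpos : 0 < (A + B) ^ 2 - 3 * (A * B) := by
    by_contra hn
    nlinarith [mul_nonneg (add_pos hA0 hB0).le (sub_nonneg.2 (not_lt.1 hn))]
  have hfac : (A + B - s) * ((A + B) ^ 2 - 3 * (A * B) + (A + B) * s + s ^ 2) = 0 := by
    linear_combination hS - hs'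
  have hne : (A + B) ^ 2 - 3 * (A * B) + (A + B) * s + s ^ 2 ≠ 0 := by positivity
  exact sub_eq_zero.1 ((mul_eq_zero.1 hfac).resolve_right hne)

/-- The ordinate, on the ray of slope `m`, of the curve `x y (x² - y²) = 2 q`. -/
noncomputable def rayOrdinate (q m : ℝ) : ℝ := (2 * q * (m ^ 3 / (1 - m ^ 2))) ^ ((1 : ℝ) / 4)

lemma cube_div_one_sub_sq_le {x b : ℝ} (hx : 0 ≤ x) (hxb : x ≤ b) (hb : b < 1) :
    x ^ 3 / (1 - x ^ 2) ≤ b ^ 3 / (1 - b ^ 2) := by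
  have hb0 : 0 ≤ b := hx.trans hxb
  have hb2 : 0 < 1 - b ^ 2 := by nlinarith
  gcongr

lemma rayOrdinate_pow_four {q m : ℝ} (hq : 0 < q) (hm0 : 0 ≤ m) (hm1 : m < 1) :
    rayOrdinate q m ^ 4 = 2 * q * (m ^ 3 / (1 - m ^ 2)) := by
  have he : 0 < 1 - m ^ 2 := by nlinarith
  rw [rayOrdinate, ← rpow_natCast, ← rpow_mul (by positivity)]
  norm_num

lemma rayOrdinate_pos {q m : ℝ} (hq : 0 < q) (hm0 : 0 < m) (hm1 : m < 1) :
    0 < rayOrdinate q m := by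
  have he : 0 < 1 - m ^ 2 := by nlinarith
  exact rpow_pos_of_pos (by positivity) _

lemma rayOrdinate_sq {q m : ℝ} (hq : 0 < q) (hm0 : 0 < m) (hm1 : m < 1) :
    rayOrdinate q m ^ 2 = √(2 * q) * m ^ 2 * lemniscaticKernel m := by
  have he : 0 < 1 - m ^ 2 := by nlinarith
  have hk : 0 ≤ lemniscaticKernel m := inv_nonneg.2 (sqrt_nonneg _)
  refine (pow_left_inj₀ (n := 2) (by positivity) (by positivity) (by norm_num)).1 ?_
  have h4 := rayOrdinate_pow_four hq hm0.le hm1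
  rw [← pow_mul, h4, mul_pow, mul_pow, sq_sqrt (by positivity), lemniscaticKernel, inv_pow,
    sq_sqrt (by positivity)]
  field_simp

lemma hasDerivAt_rayOrdinate {q m : ℝ} (hq : 0 < q) (hm0 : 0 < m) (hm1 : m < 1) :
    HasDerivAt (rayOrdinate q)
      (rayOrdinate q m * ((3 - m ^ 2) / (4 * m * (1 - m ^ 2)))) m := by
  have he : 0 < 1 - m ^ 2 := by nlinarith
  have hR : 0 < 2 * q * (m ^ 3 / (1 - m ^ 2)) := by positivity
  have hd := ((((hasDerivAt_pow 3 m).div ((hasDerivAt_pow 2 m).const_sub 1) he.ne').const_mul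
    (2 * q)).rpow_const (p := 1 / 4) (Or.inl hR.ne'))
  refine hd.congr_deriv ?_
  simp only [Pi.div_apply, rayOrdinate]
  rw [rpow_sub_one hR.ne']
  field_simp
  push_cast
  ring

lemma hasDerivAt_sqrt_div_one_sub_sq {m : ℝ} (hm0 : 0 < m) (hm1 : m < 1) :
    HasDerivAt (fun x : ℝ => √(x / (1 - x ^ 2)))
      (lemniscaticKernel m * ((1 + m ^ 2) / (2 * (1 - m ^ 2)))) m := by
  have he : 0 < 1 - m ^ 2 := by nlinarith
  have hR : 0 < m / (1 - m ^ 2) := by positivity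
  have hd := ((hasDerivAt_id m).div ((hasDerivAt_pow 2 m).const_sub 1) he.ne').sqrt hR.ne'
  refine hd.congr_deriv ?_
  simp only [id, Pi.div_apply, lemniscaticKernel]
  rw [sqrt_mul hm0.le, sqrt_div hm0.le]
  have h1 : 0 < √m := sqrt_pos.2 hm0
  have h2 : 0 < √(1 - m ^ 2) := sqrt_pos.2 he
  have h3 : √(1 - m ^ 2) ^ 2 = 1 - m ^ 2 := sq_sqrt he.le
  field_simp
  rw [h3]
  push_cast
  ring

/-- The area under the curve `x y (x² - y²) = 2 q`, up to a scalar, is that of a triangle and a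
sector; the latter is an incomplete lemniscatic integral. -/
lemma integral_cardano_sum {q b N : ℝ} (hq : 0 < q) (hb0 : 0 < b) (hb1 : b < 1)
    (hN : N = 27 * q ^ 2) (hb : 4 * (b ^ 3 / (1 - b ^ 2)) ^ 2 ≤ 27) :
    q ^ ((1 : ℝ) / 3) * ∫ t in (0 : ℝ)..rayOrdinate q b,
      t ^ (-(1 : ℝ) / 3) * ((1 + √(1 - t ^ 8 / N)) ^ ((1 : ℝ) / 3)
        + (1 - √(1 - t ^ 8 / N)) ^ ((1 : ℝ) / 3)) =
      √(2 * q) / 2 * (√(b / (1 - b ^ 2)) + ∫ m in (0 : ℝ)..b, lemniscaticKernel m) := by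
  set g : ℝ → ℝ := fun t => t ^ (-(1 : ℝ) / 3) * ((1 + √(1 - t ^ 8 / N)) ^ ((1 : ℝ) / 3)
        + (1 - √(1 - t ^ 8 / N)) ^ ((1 : ℝ) / 3)) with hg
  have hbe : 0 < 1 - b ^ 2 := by nlinarith
  have hf0 : rayOrdinate q 0 = 0 := by simp [rayOrdinate]
  have hker : IntervalIntegrable lemniscaticKernel volume 0 b :=
    intervalIntegrable_lemniscaticKernel_of_mem (by simp) ⟨hb0.le, hb1.le⟩
  have hgf : ∀ x ∈ Ioc 0 b, q ^ ((1 : ℝ) / 3) * g (rayOrdinate q x) = rayOrdinate q x / x := by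
    intro x hx
    have hx0 := hx.1
    have hx1 : x < 1 := hx.2.trans_lt hb1
    have he : 0 < 1 - x ^ 2 := by nlinarith
    have ht0 := rayOrdinate_pos hq hx0 hx1
    have ht4 := rayOrdinate_pow_four hq hx0.le hx1
    have ht8 : rayOrdinate q x ^ 8 / N = 4 * x ^ 6 / (27 * (1 - x ^ 2) ^ 2) := by
      rw [show rayOrdinate q x ^ 8 = (rayOrdinate q x ^ 4) ^ 2 by ring, ht4, hN]
      field_simp
      ring
    have hle : 4 * (x ^ 3 / (1 - x ^ 2)) ^ 2 ≤ 4 * (b ^ 3 / (1 - b ^ 2)) ^ 2 := by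
      gcongr 4 * ?_ ^ 2
      exact cube_div_one_sub_sq_le hx0.le hx.2 hb1
    have hσ := cardano_sum hx0 hx1 ht8 (by
      rw [ht8, show 4 * x ^ 6 / (27 * (1 - x ^ 2) ^ 2)
        = 4 * (x ^ 3 / (1 - x ^ 2)) ^ 2 / 27 by field_simp]
      linarith)
    rw [hg]
    simp only
    rw [hσ, ← mul_assoc]
    have h3 : 2 / (1 - x ^ 2) = q⁻¹ * rayOrdinate q x ^ 4 * (x ^ 3)⁻¹ := by
      rw [ht4]; field_simp
    rw [h3]
    generalize rayOrdinate q x = t at ht0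
    refine (pow_left_inj₀ (n := 3) (by positivity) (by positivity) (by norm_num)).1 ?_
    have cube : ∀ {y : ℝ} (e : ℝ), 0 ≤ y → (y ^ (e / 3)) ^ 3 = y ^ e := fun {y} e hy => by
      rw [← rpow_natCast, ← rpow_mul hy]; congr 1; push_cast; ring
    rw [mul_pow, mul_pow, cube _ hq.le, cube _ ht0.le, cube _ (by positivity), rpow_one, rpow_one,
      rpow_neg_one]
    field_simp
  have hpt : ∀ x ∈ Ioc 0 b, q ^ ((1 : ℝ) / 3) * ((g ∘ rayOrdinate q) x *
      (rayOrdinate q x * ((3 - x ^ 2) / (4 * x * (1 - x ^ 2))))) =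
      √(2 * q) / 2 * (lemniscaticKernel x * ((1 + x ^ 2) / (2 * (1 - x ^ 2))) +
        lemniscaticKernel x) := by
    intro x hx
    have hx0 := hx.1
    have hx1 : x < 1 := hx.2.trans_lt hb1
    have he : 0 < 1 - x ^ 2 := by nlinarith
    have hsq := rayOrdinate_sq hq hx0 hx1
    rw [Function.comp, ← mul_assoc, hgf x hx]
    calc _ = rayOrdinate q x ^ 2 * ((3 - x ^ 2) / (4 * x ^ 2 * (1 - x ^ 2))) := by
          field_simp
      _ = _ := by rw [hsq]; field_simp; ring
  have hcont : ContinuousOn (fun x : ℝ => (1 + x ^ 2) / (2 * (1 - x ^ 2))) (uIcc 0 b) := by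
    refine ContinuousOn.div (by fun_prop) (by fun_prop) fun x hx => ?_
    rw [uIcc_of_le hb0.le] at hx
    nlinarith [hx.1, hx.2]
  have hHint := hker.mul_continuousOn hcont
  have hq3 : 0 < q ^ ((1 : ℝ) / 3) := rpow_pos_of_pos hq _
  have hsub := integral_comp_mul_deriv''' (a := 0) (b := b) (f := rayOrdinate q)
    (f' := fun x => rayOrdinate q x * ((3 - x ^ 2) / (4 * x * (1 - x ^ 2)))) (g := g)
    (by
      refine ContinuousOn.rpow_const (ContinuousOn.mul continuousOn_const
        (ContinuousOn.div (by fun_prop) (by fun_prop) fun x hx => ?_)) fun x _ => Or.inr (by norm_num)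
      rw [uIcc_of_le hb0.le] at hx
      nlinarith [hx.1, hx.2])
    (fun x hx => by
      rw [min_eq_left hb0.le, max_eq_right hb0.le] at hx
      exact (hasDerivAt_rayOrdinate hq hx.1 (hx.2.trans hb1)).hasDerivWithinAt)
    (by
      rw [min_eq_left hb0.le, max_eq_right hb0.le]
      rintro _ ⟨x, hx, rfl⟩
      have hpos := rayOrdinate_pos hq hx.1 (hx.2.trans hb1)
      refine ContinuousAt.continuousWithinAt ?_
      refine (continuousAt_id.rpow_const (Or.inl hpos.ne')).mul (ContinuousAt.add ?_ ?_)
      all_goals exact ContinuousAt.rpow_const (by fun_prop) (Or.inr (by norm_num)))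
    (by
      have hgint : IntervalIntegrable g volume 0 (rayOrdinate q b) := by
        refine (intervalIntegrable_rpow' (by norm_num)).mul_continuousOn (ContinuousOn.add ?_ ?_)
        all_goals exact ContinuousOn.rpow_const (by fun_prop) fun _ _ => Or.inr (by norm_num)
      refine ((intervalIntegrable_iff').1 hgint).mono_set ?_
      rw [uIcc_of_le hb0.le, uIcc_of_le (rayOrdinate_pos hq hb0 hb1).le]
      rintro _ ⟨x, hx, rfl⟩
      have he : 0 < 1 - x ^ 2 := by nlinarith [hx.1, hx.2]
      have hx0 := hx.1
      refine ⟨rpow_nonneg (by positivity) _, rpow_le_rpow (by positivity) ?_ (by norm_num)⟩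
      exact mul_le_mul_of_nonneg_left (cube_div_one_sub_sq_le hx.1 hx.2 hb1) (by positivity))
    (by
      rw [← intervalIntegrable_iff']
      refine (((hHint.add hker).const_mul (√(2 * q) / 2)).const_mul
        (q ^ ((1 : ℝ) / 3))⁻¹).congr fun x hx => ?_
      rw [uIoc_of_le hb0.le] at hx
      rw [← hpt x hx, inv_mul_cancel_left₀ hq3.ne'])
  have hcongr := integral_congr_ae (μ := volume) (a := 0) (b := b) (ae_of_all _ fun x hx =>
    hpt x (by rwa [uIoc_of_le hb0.le] at hx))
  have hFTC := integral_eq_sub_of_hasDerivAt_of_le (a := 0) (b := b)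
    (f := fun x : ℝ => √(x / (1 - x ^ 2))) hb0.le
    (by
      refine (ContinuousOn.div (by fun_prop) (by fun_prop) fun x hx => ?_).sqrt
      nlinarith [hx.1, hx.2])
    (fun x hx => hasDerivAt_sqrt_div_one_sub_sq hx.1 (hx.2.trans hb1)) hHint
  rw [intervalIntegral.integral_const_mul, intervalIntegral.integral_const_mul, hsub, hf0,
    integral_add hHint hker, hFTC] at hcongr
  simpa using hcongr

lemma rayOrdinate_eq_rpow_neg {q b : ℝ} (h : 2 * q * (b ^ 3 / (1 - b ^ 2)) = 3⁻¹) :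
    rayOrdinate q b = (3 : ℝ) ^ (-(1 : ℝ) / 4) := by
  rw [rayOrdinate, h, inv_rpow (by norm_num), ← rpow_neg (by norm_num)]
  norm_num

theorem G1_plus_G2_exact_value :
    G1 0 + 2 ^ (-(1:ℝ)/3) * G2 0 =
      7 * Real.sqrt 3 / 12 + Real.Gamma (1/4) ^ 2 / (4 * Real.sqrt π) := by
  have h1 := integral_cardano_sum (q := 1) (b := 1 / 2) (N := 27) (by norm_num) (by norm_num)
    (by norm_num) (by norm_num) (by norm_num)
  have h2 := integral_cardano_sum (q := 4) (b := 1 / 3) (N := 432) (by norm_num) (by norm_num)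
    (by norm_num) (by norm_num) (by norm_num)
  rw [rayOrdinate_eq_rpow_neg (by norm_num)] at h1 h2
  rw [← G1, one_rpow, one_mul] at h1
  rw [← G2] at h2
  have h4 : (4 : ℝ) ^ ((1 : ℝ) / 3) = 2 * 2 ^ (-(1 : ℝ) / 3) := by
    rw [show (4 : ℝ) = 2 ^ (2 : ℝ) by norm_num, ← rpow_mul (by norm_num),
      ← rpow_one_add' (by norm_num) (by norm_num)]
    norm_num
  have h8 : √(2 * 4) = 2 * √2 := by
    rw [mul_comm, show (4 : ℝ) = 2 ^ 2 by norm_num, sqrt_mul (by norm_num),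
      sqrt_sq (by norm_num)]
  have hs1 : √2 * √(1 / 2 / (1 - (1 / 2) ^ 2)) = 2 * √3 / 3 := by
    rw [← sqrt_mul (by norm_num), sqrt_eq_iff_mul_self_eq (by norm_num) (by positivity)]
    ring_nf
    norm_num
  have hs2 : √2 * √(1 / 3 / (1 - (1 / 3) ^ 2)) = √3 / 2 := by
    rw [← sqrt_mul (by norm_num), sqrt_eq_iff_mul_self_eq (by norm_num) (by positivity)]
    ring_nf
    norm_num
  have hadd := integral_add_adjacent_intervals
    (intervalIntegrable_lemniscaticKernel_of_mem (a := 0) (b := 1 / 2) (by norm_num) (by norm_num))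
    (intervalIntegrable_lemniscaticKernel_of_mem (a := 1 / 2) (b := 1) (by norm_num) (by norm_num))
  rw [integral_lemniscaticKernel, ← integral_lemniscaticKernel_mobius] at hadd
  have h22 : √2 * √2 = 2 := mul_self_sqrt zero_le_two
  rw [h4, h8] at h2
  rw [mul_one] at h1
  have hΓ : Gamma (1 / 4) ^ 2 / (4 * √π) = Gamma (1 / 4) ^ 2 / (2 * √π) / 2 := by
    rw [div_div]; ring_nf
  rw [hΓ]
  linear_combination h1 + h2 / 2 + hs1 / 2 + hs2 / 2 + √2 / 2 * hadd
    + (Gamma (1 / 4) ^ 2 / (2 * √π)) / 4 * h22
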